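/- arXiv:1006.4227 — 10 statements merged into one kernel-verified Lean document; each statement's English description precedes it below -/
import Mathlib

section
/- Let k be a commutative ring, A a commutative k-algebra, L a Lie algebra over k which is also an A-module (with compatible k-scalar actions), and ρ : L → Der_k(A) an A-linear map into the Lie algebra of k-linear derivations of A such that the Leibniz rule ⁅f • X, Y⁆ = f • ⁅X, Y⁆ − (ρ(Y) f) • X holds for all f ∈ A and X, Y ∈ L. If the A-action on L is faithful (f • X = 0 for all X ∈ L implies f = 0), then the anchor ρ is a homomorphism of Lie algebras: ρ(⁅X, Y⁆) = ⁅ρ(X), ρ(Y)⁆ (commutator of derivations) for all X, Y ∈ L. -/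
/-- Herz's lemma (algebraic / Lie–Rinehart form): if the Leibniz rule
`⁅f • X, Y⁆ = f • ⁅X, Y⁆ − (ρ Y f) • X` holds and the `A`-action on `L` is
faithful, then the anchor `ρ` is a Lie algebra homomorphism. -/
theorem anchor_is_lie_hom
    (k A L : Type*) [CommRing k] [CommRing A] [Algebra k A]
    [LieRing L] [LieAlgebra k L] [Module A L] [IsScalarTower k A L]
    (ρ : L →ₗ[A] Derivation k A A)
    (hLeib : ∀ (f : A) (X Y : L), ⁅f • X, Y⁆ = f • ⁅X, Y⁆ - (ρ Y f) • X)
    (hfaith : ∀ f : A, (∀ X : L, f • X = 0) → f = 0) :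
    ∀ X Y : L, ρ ⁅X, Y⁆ = ⁅ρ X, ρ Y⁆ := by
  have hR : ∀ (f : A) (X Y : L), ⁅Y, f • X⁆ = f • ⁅Y, X⁆ + (ρ Y f) • X := by
    intro f X Y
    rw [← lie_skew Y (f • X), hLeib, ← lie_skew Y X, smul_neg]
    abel
  intro X Y
  ext f
  rw [← sub_eq_zero]
  apply hfaith
  intro Z
  have h := lie_lie X Y (f • Z)
  simp only [hR, lie_add] at h
  rw [lie_lie X Y Z, smul_sub] at h
  rw [Derivation.commutator_apply, sub_smul, sub_smul]
  rw [← sub_eq_zero] at h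
  refine Eq.trans ?_ h
  abel
end

section
/- For all p, q ∈ R one has E_{A₂(p)}(A₂(q)) − E_{A₂(q)}(A₂(p)) = A₂([p,q]_{A₂}), where [p,q]_{A₂} := E_{A₂(p)}(q) − E_{A₂(q)}(p) + D(p)·q − p·D(q). Equivalently, since the commutator of evolutionary derivations E_φ, E_ψ is the evolutionary derivation with generating section E_φ(ψ) − E_ψ(φ), the image of the operator A₂ is closed under commutation of evolutionary vector fields, the induced bracket on its domain being [·,·]_{A₂}. -/
open MvPolynomial

/-- The image of the second Hamiltonian operator `A₂` of KdV is closed under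
commutation of evolutionary vector fields, with induced bracket
`[p,q] = E_{A₂ p}(q) − E_{A₂ q}(p) + D(p)·q − p·D(q)`. -/
theorem kdv_A2_image_closed
    (D : Derivation ℚ (MvPolynomial ℕ ℚ) (MvPolynomial ℕ ℚ))
    (hD : ∀ n : ℕ, D (X n) = X (n + 1))
    (E : MvPolynomial ℕ ℚ → Derivation ℚ (MvPolynomial ℕ ℚ) (MvPolynomial ℕ ℚ))
    (hE : ∀ (φ : MvPolynomial ℕ ℚ) (n : ℕ), E φ (X n) = (D.toLinearMap ^ n) φ)
    (A₂ : MvPolynomial ℕ ℚ → MvPolynomial ℕ ℚ)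
    (hA₂ : ∀ p, A₂ p = -((1 : ℚ)/2) • (D.toLinearMap ^ 3) p
        + 2 * X 0 * D p + X 1 * p) :
    ∀ p q : MvPolynomial ℕ ℚ,
      E (A₂ p) (A₂ q) - E (A₂ q) (A₂ p)
        = A₂ (E (A₂ p) q - E (A₂ q) p + D p * q - p * D q) := by
  have hc : ∀ φ r, E φ (D r) = D (E φ r) := by
    intro φ r
    have h : ⁅E φ, D⁆ = 0 := by
      apply MvPolynomial.derivation_ext
      intro n
      rw [Derivation.commutator_apply, hD, hE, hE, pow_succ']
      simp
    have h2 := congrArg (fun d => d r) h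
    simp only [Derivation.commutator_apply, Derivation.coe_zero, Pi.zero_apply] at h2
    exact sub_eq_zero.mp h2
  have h3 : ∀ r, (D.toLinearMap ^ 3) r = D (D (D r)) := by
    intro r
    simp [pow_succ]
  have hA : ∀ r, A₂ r = C (-((1 : ℚ)/2)) * D (D (D r)) + (X 0 * D r + X 0 * D r) + X 1 * r := by
    intro r
    rw [hA₂, h3, smul_eq_C_mul]
    ring
  have hDC : ∀ a : ℚ, D (C a) = 0 := fun a => D.map_algebraMap a
  have hEC : ∀ φ (a : ℚ), E φ (C a) = 0 := fun φ a => (E φ).map_algebraMap a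
  have hE0 : ∀ φ, E φ (X 0) = φ := by
    intro φ
    simp [hE]
  have hE1 : ∀ φ, E φ (X 1) = D φ := by
    intro φ
    simp [hE]
  have key : ∀ φ r, E φ (A₂ r) = A₂ (E φ r) + (φ * D r + φ * D r) + D φ * r := by
    intro φ r
    rw [hA r, hA (E φ r)]
    simp only [map_add, Derivation.leibniz, smul_eq_mul, hc, hEC, hE0, hE1]
    ring
  intro p q
  rw [key, key]
  generalize E (A₂ p) q = u
  generalize E (A₂ q) p = v
  simp only [hA, map_add, map_sub, Derivation.leibniz, smul_eq_mul, hD, hDC]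
  generalize C (-((1 : ℚ)/2)) = c
  ring
end

section
/- The bracket [p,q]_{A₂} := E_{A₂(p)}(q) − E_{A₂(q)}(p) + D(p)·q − p·D(q) satisfies the Jacobi identity: for all p, q, r ∈ R, [[p,q]_{A₂}, r]_{A₂} + [[q,r]_{A₂}, p]_{A₂} + [[r,p]_{A₂}, q]_{A₂} = 0. Together with its evident antisymmetry this makes (R, [·,·]_{A₂}) a Lie algebra over ℚ. -/
open MvPolynomial

/-- The bracket `[p,q]_{A₂} = E_{A₂ p}(q) − E_{A₂ q}(p) + D(p)·q − p·D(q)`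
induced by the second Hamiltonian operator of KdV is antisymmetric and
satisfies the Jacobi identity. -/
theorem kdv_A2_bracket_jacobi
    (D : Derivation ℚ (MvPolynomial ℕ ℚ) (MvPolynomial ℕ ℚ))
    (hD : ∀ n : ℕ, D (X n) = X (n + 1))
    (E : MvPolynomial ℕ ℚ → Derivation ℚ (MvPolynomial ℕ ℚ) (MvPolynomial ℕ ℚ))
    (hE : ∀ (φ : MvPolynomial ℕ ℚ) (n : ℕ), E φ (X n) = (D.toLinearMap ^ n) φ)
    (A₂ : MvPolynomial ℕ ℚ → MvPolynomial ℕ ℚ)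
    (hA₂ : ∀ p, A₂ p = -((1 : ℚ)/2) • (D.toLinearMap ^ 3) p
        + 2 * X 0 * D p + X 1 * p)
    (B : MvPolynomial ℕ ℚ → MvPolynomial ℕ ℚ → MvPolynomial ℕ ℚ)
    (hB : ∀ p q, B p q = E (A₂ p) q - E (A₂ q) p + D p * q - p * D q) :
    (∀ p q : MvPolynomial ℕ ℚ, B p q = - B q p) ∧
    (∀ p q r : MvPolynomial ℕ ℚ,
      B (B p q) r + B (B q r) p + B (B r p) q = 0) := by
  have hc : ∀ φ f, E φ (D f) = D (E φ f) := by
    intro φ f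
    have h : ⁅E φ, D⁆ = 0 := by
      apply MvPolynomial.derivation_ext
      intro n
      rw [Derivation.commutator_apply, hD, hE, hE, pow_succ']
      simp
    have h2 := congrArg (fun d => d f) h
    simp only [Derivation.commutator_apply, Derivation.coe_zero, Pi.zero_apply] at h2
    exact sub_eq_zero.mp h2
  have hcn : ∀ φ (n : ℕ) f, E φ ((D.toLinearMap ^ n) f) = (D.toLinearMap ^ n) (E φ f) := by
    intro φ n f
    induction n with
    | zero => simp
    | succ n ih =>
      rw [pow_succ']
      simp only [Module.End.mul_apply, Derivation.coeFn_coe] at ih ⊢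
      rw [hc, ih]
  have hcomm : ∀ φ ψ f, E φ (E ψ f) - E ψ (E φ f) = E (E φ ψ - E ψ φ) f := by
    intro φ ψ f
    have h : ⁅E φ, E ψ⁆ = E (E φ ψ - E ψ φ) := by
      apply MvPolynomial.derivation_ext
      intro n
      rw [Derivation.commutator_apply, hE, hE, hE, hcn, hcn, map_sub]
    rw [← h, Derivation.commutator_apply]
  have hA : ∀ p, A₂ p = C (-(1/2 : ℚ)) * D (D (D p)) + 2 * X 0 * D p + X 1 * p := by
    intro p
    rw [hA₂, MvPolynomial.smul_eq_C_mul]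
    simp [pow_succ]
  have h0 : ∀ φ, E φ (X 0) = φ := by intro φ; simp [hE]
  have h1 : ∀ φ, E φ (X 1) = D φ := by intro φ; simp [hE]
  have hDC : ∀ c : ℚ, D (C c) = 0 := fun c => D.map_algebraMap c
  have hEC : ∀ φ (c : ℚ), E φ (C c) = 0 := fun φ c => (E φ).map_algebraMap c
  have h2D : ∀ d : Derivation ℚ (MvPolynomial ℕ ℚ) (MvPolynomial ℕ ℚ), d 2 = 0 :=
    fun d => by have h := d.map_natCast 2; rwa [Nat.cast_ofNat] at h
  have hEA : ∀ φ q, E φ (A₂ q) = A₂ (E φ q) + 2 * φ * D q + D φ * q := by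
    intro φ q
    rw [hA q, hA (E φ q)]
    simp only [map_add, Derivation.leibniz, smul_eq_mul, hc, h0, h1, hEC, h2D]
    ring
  have hhalf : (2 : MvPolynomial ℕ ℚ) * C (-(1/2 : ℚ)) = -1 := by
    have : (2 : MvPolynomial ℕ ℚ) = C (2 : ℚ) := (map_ofNat C 2).symm
    rw [this, ← C_mul]
    norm_num
  have hAB : ∀ p q, A₂ (B p q) = E (A₂ p) (A₂ q) - E (A₂ q) (A₂ p) := by
    intro p q
    rw [hEA, hEA, hB]
    generalize E (A₂ p) q = u
    generalize E (A₂ q) p = v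
    simp only [hA, map_add, map_sub, Derivation.leibniz, smul_eq_mul, hDC, h2D, hD]
    ring
  have key : ∀ p q f, E (A₂ (B p q)) f = E (A₂ p) (E (A₂ q) f) - E (A₂ q) (E (A₂ p) f) := by
    intro p q f
    rw [hAB, hcomm]
  refine ⟨fun p q => by rw [hB, hB]; ring, fun p q r => ?_⟩
  rw [hB (B p q), hB (B q r), hB (B r p), key, key, key, hB p q, hB q r, hB r p]
  simp only [map_add, map_sub, Derivation.leibniz, smul_eq_mul, hc]
  ring
end

section
/- For all p, q ∈ R one has 2·A₂(p)·D(q) + D(A₂(p))·q − 2·A₂(q)·D(p) − D(A₂(q))·p = A₂(D(p)·q − p·D(q)). In other words, (∂_{A₂(p)}A₂)(q) − (∂_{A₂(q)}A₂)(p) = A₂({{p,q}}_{A₂}) with {{p,q}}_{A₂} = D(p)·q − p·D(q), which is the Hamiltonianity criterion (∂_{A(p)}(A))(q) − (∂_{A(q)}(A))(p) = A((ℓ_{A,p})†(q)) evaluated for the operator A₂. -/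
open MvPolynomial

/-- The Hamiltonianity criterion
`(∂_{A₂(p)}A₂)(q) − (∂_{A₂(q)}A₂)(p) = A₂({{p,q}}_{A₂})` with
`{{p,q}}_{A₂} = D(p)·q − p·D(q)`, evaluated for the second KdV operator:
`(∂_φ A₂)(q) = 2·φ·D(q) + D(φ)·q`. -/
theorem kdv_A2_hamiltonian_criterion
    (D : Derivation ℚ (MvPolynomial ℕ ℚ) (MvPolynomial ℕ ℚ))
    (hD : ∀ n : ℕ, D (X n) = X (n + 1))
    (A₂ : MvPolynomial ℕ ℚ → MvPolynomial ℕ ℚ)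
    (hA₂ : ∀ p, A₂ p = -((1 : ℚ)/2) • (D.toLinearMap ^ 3) p
        + 2 * X 0 * D p + X 1 * p) :
    ∀ p q : MvPolynomial ℕ ℚ,
      2 * A₂ p * D q + D (A₂ p) * q - 2 * A₂ q * D p - D (A₂ q) * p
        = A₂ (D p * q - p * D q) := by
  intro p q
  have h2 : D (2 : MvPolynomial ℕ ℚ) = 0 := by
    simpa using D.map_natCast 2
  have h3 : ∀ r, (D.toLinearMap ^ 3) r = D (D (D r)) := fun r => rfl
  simp only [hA₂, h3, map_add, map_sub, Derivation.leibniz, smul_eq_mul, hD, h2,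
    Derivation.map_smul, MvPolynomial.smul_eq_C_mul]
  have hc : (C (-((1 : ℚ)/2)) : MvPolynomial ℕ ℚ) = C (-((1 : ℚ)/2)) := rfl
  have hC : ∀ a : ℚ, D (C a) = 0 := fun a => D.map_algebraMap a
  simp only [hC]
  ring
end

section
/- The operator A₂ is Hamiltonian: defining the variational Poisson bracket {f,g} := (δf/δw)·A₂(δg/δw) for f, g ∈ R, the Jacobi identity holds modulo total derivatives, i.e. for all f, g, h ∈ R the cyclic sum {{f,g},h} + {{g,h},f} + {{h,f},g} lies in the range of the total derivative D. -/
open MvPolynomial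

namespace KdVAux

abbrev R := MvPolynomial ℕ ℚ

/-- evolutionary derivation -/
noncomputable def ev (D : Derivation ℚ R R) (Q : R) : Derivation ℚ R R :=
  mkDerivation ℚ (fun n => (D.toLinearMap ^ n) Q)

lemma ev_X (D : Derivation ℚ R R) (Q : R) (n : ℕ) :
    ev D Q (X n) = (D.toLinearMap ^ n) Q := by
  simp [ev, mkDerivation_X]

lemma pow_succ_ap (D : Derivation ℚ R R) (Q : R) (n : ℕ) :
    (D.toLinearMap ^ (n+1)) Q = D ((D.toLinearMap ^ n) Q) := by
  rw [pow_succ']; rfl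

lemma ev_comm (D : Derivation ℚ R R) (hD : ∀ n : ℕ, D (X n) = X (n + 1)) (Q p : R) :
    ev D Q (D p) = D (ev D Q p) := by
  have h : ⁅ev D Q, D⁆ = 0 := by
    apply MvPolynomial.derivation_ext
    intro i
    rw [Derivation.commutator_apply, hD, ev_X, ev_X, pow_succ_ap]
    simp
  have h2 := congrArg (fun E : Derivation ℚ R R => E p) h
  simp only [Derivation.commutator_apply, Derivation.coe_zero, Pi.zero_apply] at h2
  exact sub_eq_zero.mp h2

lemma ev_comm_pow (D : Derivation ℚ R R) (hD : ∀ n : ℕ, D (X n) = X (n + 1)) (Q p : R)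
    (n : ℕ) : ev D Q ((D.toLinearMap ^ n) p) = (D.toLinearMap ^ n) (ev D Q p) := by
  induction n with
  | zero => simp
  | succ n ih => rw [pow_succ_ap, pow_succ_ap, ev_comm D hD, ih]

lemma ev_bracket (D : Derivation ℚ R R) (hD : ∀ n : ℕ, D (X n) = X (n + 1)) (P Q f : R) :
    ev D P (ev D Q f) - ev D Q (ev D P f) = ev D (ev D P Q - ev D Q P) f := by
  have h : ⁅ev D P, ev D Q⁆ = ev D (ev D P Q - ev D Q P) := by
    apply MvPolynomial.derivation_ext
    intro i
    rw [Derivation.commutator_apply, ev_X, ev_X, ev_X, ev_comm_pow D hD, ev_comm_pow D hD,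
      map_sub]
  rw [← h, Derivation.commutator_apply]

lemma parts (D : Derivation ℚ R R) (Q r : R) (n : ℕ) :
    (D.toLinearMap ^ n) Q * r - Q * ((-1) ^ n * (D.toLinearMap ^ n) r)
      ∈ LinearMap.range D.toLinearMap := by
  induction n generalizing r with
  | zero => simp
  | succ n ih =>
    obtain ⟨u, hu⟩ := ih (D r)
    refine ⟨(D.toLinearMap ^ n) Q * r - u, ?_⟩
    have e : (D.toLinearMap ^ (n+1)) r = (D.toLinearMap ^ n) (D r) := by
      rw [pow_succ]; rfl
    rw [map_sub, hu, pow_succ_ap, e, Derivation.coeFn_coe, Derivation.leibniz]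
    simp only [smul_eq_mul]
    ring

lemma der_sum (s : Finset ℕ) (E : ℕ → Derivation ℚ R R) (p : R) :
    (∑ n ∈ s, E n) p = ∑ n ∈ s, E n p :=
  map_sum (⟨⟨fun F : Derivation ℚ R R => F p, rfl⟩, fun _ _ => rfl⟩ : Derivation ℚ R R →+ R) E s

lemma ev_sum (D : Derivation ℚ R R) (Q f : R) :
    ev D Q f = ∑ n ∈ f.vars, (D.toLinearMap ^ n) Q * pderiv n f := by
  have h : Set.EqOn (ev D Q)
      (∑ n ∈ f.vars, ((D.toLinearMap ^ n) Q) • (pderiv n : Derivation ℚ R R) : Derivation ℚ R R)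
      (supported ℚ (f.vars : Set ℕ)) := by
    apply MvPolynomial.derivation_eqOn_supported
    intro i hi
    have hi' : i ∈ f.vars := hi
    simp only [Function.comp, ev_X, der_sum, Derivation.smul_apply]
    rw [Finset.sum_eq_single i]
    · simp
    · intro b _ hb
      rw [pderiv_X_of_ne hb.symm]; simp
    · intro h; exact absurd hi' h
  have := h (mem_supported_vars f)
  rw [this]
  simp [der_sum]

lemma ev_Vd (D : Derivation ℚ R R) (Vd : R → R)
    (hVd : ∀ f, Vd f = ∑ᶠ n : ℕ, (-1 : R) ^ n * (D.toLinearMap ^ n) (pderiv n f)) (Q f : R) :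
    ev D Q f - Q * Vd f ∈ LinearMap.range D.toLinearMap := by
  have : Vd f = ∑ n ∈ f.vars, (-1 : R) ^ n * (D.toLinearMap ^ n) (pderiv n f) := by
    rw [hVd]
    apply finsum_eq_sum_of_support_subset
    intro n hn
    by_contra hc
    apply hn
    have : pderiv n f = 0 := pderiv_eq_zero_of_notMem_vars (by simpa using hc)
    simp [this]
  rw [this, ev_sum, Finset.mul_sum, ← Finset.sum_sub_distrib]
  exact Submodule.sum_mem _ fun n _ => parts D Q _ n

lemma selfadj (D : Derivation ℚ R R) (hD : ∀ n : ℕ, D (X n) = X (n + 1)) (Vd : R → R)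
    (hVd : ∀ f, Vd f = ∑ᶠ n : ℕ, (-1 : R) ^ n * (D.toLinearMap ^ n) (pderiv n f)) (P Q f : R) :
    ∃ u, D u = Q * ev D P (Vd f) - P * ev D Q (Vd f) := by
  obtain ⟨a, ha⟩ := ev_Vd D Vd hVd Q f
  obtain ⟨b, hb⟩ := ev_Vd D Vd hVd P f
  obtain ⟨c, hc⟩ := ev_Vd D Vd hVd (ev D P Q - ev D Q P) f
  rw [Derivation.coeFn_coe] at ha hb hc
  have ha' := congrArg (ev D P) ha
  have hb' := congrArg (ev D Q) hb
  rw [ev_comm D hD, map_sub, Derivation.leibniz] at ha' hb'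
  refine ⟨c - ev D P a + ev D Q b, ?_⟩
  rw [map_add, map_sub, ha', hb', hc, ← ev_bracket D hD]
  simp only [smul_eq_mul]
  ring

end KdVAux

open KdVAux in
/-- The operator `A₂` is Hamiltonian: the variational Poisson bracket
`{f,g} = (δf/δw)·A₂(δg/δw)` satisfies the Jacobi identity modulo total
derivatives.  Here `δf/δw = ∑ₙ (−1)ⁿ·Dⁿ(∂f/∂wₙ)`. -/
theorem kdv_A2_poisson_jacobi
    (D : Derivation ℚ (MvPolynomial ℕ ℚ) (MvPolynomial ℕ ℚ))
    (hD : ∀ n : ℕ, D (X n) = X (n + 1))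
    (A₂ : MvPolynomial ℕ ℚ → MvPolynomial ℕ ℚ)
    (hA₂ : ∀ p, A₂ p = -((1 : ℚ)/2) • (D.toLinearMap ^ 3) p
        + 2 * X 0 * D p + X 1 * p)
    (Vd : MvPolynomial ℕ ℚ → MvPolynomial ℕ ℚ)
    (hVd : ∀ f, Vd f = ∑ᶠ n : ℕ,
        (-1 : MvPolynomial ℕ ℚ) ^ n * (D.toLinearMap ^ n) (pderiv n f))
    (Pb : MvPolynomial ℕ ℚ → MvPolynomial ℕ ℚ → MvPolynomial ℕ ℚ)
    (hPb : ∀ f g, Pb f g = Vd f * A₂ (Vd g)) :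
    ∀ f g h : MvPolynomial ℕ ℚ,
      Pb (Pb f g) h + Pb (Pb g h) f + Pb (Pb h f) g
        ∈ Set.range (D : MvPolynomial ℕ ℚ → MvPolynomial ℕ ℚ) := by
  obtain ⟨c, hc⟩ : ∃ c : MvPolynomial ℕ ℚ, c = C (-((1:ℚ)/2)) := ⟨_, rfl⟩
  have hDc : D c = 0 := by rw [hc, ← algebraMap_eq]; exact D.map_algebraMap _
  have hA : ∀ p, A₂ p = c * D (D (D p)) + 2 * X 0 * D p + X 1 * p := by
    intro p
    rw [hA₂, hc, ← smul_eq_C_mul]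
    rfl
  have hD2 : D (2 : MvPolynomial ℕ ℚ) = 0 := by
    have := D.map_natCast 2
    simpa using this
  have L : ∀ p q, D (p * q) = p * D q + q * D p := fun p q => by
    rw [Derivation.leibniz]; simp
  -- skew-adjointness of A₂
  have skew : ∀ p q, ∃ u, D u = p * A₂ q + A₂ p * q := by
    intro p q
    refine ⟨c * (p * D (D q) - D p * D q + D (D p) * q) + 2 * X 0 * p * q, ?_⟩
    rw [hA, hA]
    simp only [map_add, map_sub, L, hDc, hD2, hD]
    ring
  have evA : ∀ Q p, ev D Q (A₂ p) = A₂ (ev D Q p) + 2 * Q * D p + D Q * p := by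
    intro Q p
    have L' : ∀ p q, ev D Q (p * q) = p * ev D Q q + q * ev D Q p := fun p q => by
      rw [Derivation.leibniz]; simp
    have h1 : ev D Q c = 0 := by rw [hc, ← algebraMap_eq]; exact (ev D Q).map_algebraMap _
    have h2 : ev D Q (2 : MvPolynomial ℕ ℚ) = 0 := by
      have := (ev D Q).map_natCast 2
      simpa using this
    have h3 : ev D Q (X 0) = Q := by rw [ev_X]; simp
    have h4 : ev D Q (X 1) = D Q := by rw [ev_X]; simp
    rw [hA, hA]
    simp only [map_add, L', h1, h2, h3, h4, ev_comm D hD]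
    ring
  have key : ∀ f g h, ∃ u, D u = Pb (Pb f g) h -
      (A₂ (Vd g) * ev D (A₂ (Vd h)) (Vd f) - A₂ (Vd f) * ev D (A₂ (Vd h)) (Vd g)
        + Vd f * (2 * A₂ (Vd h) * D (Vd g) + D (A₂ (Vd h)) * Vd g)) := by
    intro f g h
    obtain ⟨a, ha⟩ := ev_Vd D Vd hVd (A₂ (Vd h)) (Pb f g)
    obtain ⟨b, hb⟩ := skew (Vd f) (ev D (A₂ (Vd h)) (Vd g))
    rw [Derivation.coeFn_coe] at ha
    refine ⟨b - a, ?_⟩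
    rw [map_sub, ha, hb, hPb (Pb f g) h, hPb f g, Derivation.leibniz, evA]
    simp only [smul_eq_mul]
    ring
  have loc : ∀ F G H, ∃ u, D u =
      F * (2 * A₂ H * D G + D (A₂ H) * G) + G * (2 * A₂ F * D H + D (A₂ F) * H)
       + H * (2 * A₂ G * D F + D (A₂ G) * F) := by
    intro F G H
    refine ⟨F * G * A₂ H + G * H * A₂ F + H * F * A₂ G
      + X 0 * (H * (F * D G - D F * G) + F * (G * D H - D G * H) + G * (H * D F - D H * F))
      + c * (D (D H) * (F * D G - D F * G) + D (D F) * (G * D H - D G * H)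
        + D (D G) * (H * D F - D H * F)), ?_⟩
    simp only [hA, map_add, map_sub, L, hDc, hD2, hD]
    ring
  intro f g h
  obtain ⟨k1, h1⟩ := key f g h
  obtain ⟨k2, h2⟩ := key g h f
  obtain ⟨k3, h3⟩ := key h f g
  obtain ⟨l, hl⟩ := loc (Vd f) (Vd g) (Vd h)
  obtain ⟨s1, t1⟩ := selfadj D hD Vd hVd (A₂ (Vd h)) (A₂ (Vd g)) f
  obtain ⟨s2, t2⟩ := selfadj D hD Vd hVd (A₂ (Vd f)) (A₂ (Vd h)) g
  obtain ⟨s3, t3⟩ := selfadj D hD Vd hVd (A₂ (Vd g)) (A₂ (Vd f)) h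
  refine ⟨k1 + k2 + k3 + l + s1 + s2 + s3, ?_⟩
  simp only [map_add, h1, h2, h3, hl, t1, t2, t3]
  ring
end

section
/- The operator A₂ is injective: for every p ∈ R, if A₂(p) = 0 then p = 0. (Hence the variational anchor A₂ has trivial kernel and the bracket [·,·]_{A₂} it induces on its domain is defined without any ambiguity modulo ker A₂.) -/
open MvPolynomial

lemma kdv_comm_succ (D : Derivation ℚ (MvPolynomial ℕ ℚ) (MvPolynomial ℕ ℚ))
    (hD : ∀ n : ℕ, D (X n) = X (n + 1)) (m : ℕ) (q : MvPolynomial ℕ ℚ) :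
    pderiv (m + 1) (D q) = pderiv m q + D (pderiv (m + 1) q) := by
  have h : ⁅(pderiv (m + 1) : Derivation ℚ (MvPolynomial ℕ ℚ) (MvPolynomial ℕ ℚ)), D⁆
      = pderiv m := by
    apply MvPolynomial.derivation_ext
    intro i
    rw [Derivation.commutator_apply, hD]
    simp only [pderiv_X, Pi.single_apply]
    by_cases h1 : i = m
    · subst h1; simp
    · by_cases h2 : i = m + 1
      · subst h2; simp
      · simp [h1, h2]
  have h' := congrArg (fun d => d q) h
  simp only [Derivation.commutator_apply] at h'
  rw [← h']; ring

/-- The second KdV Hamiltonian operator `A₂` is injective. -/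
theorem kdv_A2_injective
    (D : Derivation ℚ (MvPolynomial ℕ ℚ) (MvPolynomial ℕ ℚ))
    (hD : ∀ n : ℕ, D (X n) = X (n + 1))
    (A₂ : MvPolynomial ℕ ℚ → MvPolynomial ℕ ℚ)
    (hA₂ : ∀ p, A₂ p = -((1 : ℚ)/2) • (D.toLinearMap ^ 3) p
        + 2 * X 0 * D p + X 1 * p) :
    ∀ p : MvPolynomial ℕ ℚ, A₂ p = 0 → p = 0 := by
  intro p hp
  have c := kdv_comm_succ D hD
  rw [hA₂] at hp
  have h3 : (D.toLinearMap ^ 3) p = D (D (D p)) := by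
    simp [pow_succ]
  rw [h3] at hp
  have key : ∀ n, (∀ m, n + 1 ≤ m → pderiv m p = 0) → ∀ m, n ≤ m → pderiv m p = 0 := by
    intro n ih m hm
    rcases Nat.eq_or_lt_of_le hm with rfl | hlt
    · have e1 := ih (n + 1) (by omega)
      have e2 := ih (n + 2) (by omega)
      have e3 := ih (n + 3) (by omega)
      have h := congrArg (pderiv (n + 3)) hp
      have x0 : pderiv (n + 3) (X 0 : MvPolynomial ℕ ℚ) = 0 := pderiv_X_of_ne (by omega)
      have x1 : pderiv (n + 3) (X 1 : MvPolynomial ℕ ℚ) = 0 := pderiv_X_of_ne (by omega)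
      have two : pderiv (n + 3) (2 : MvPolynomial ℕ ℚ) = 0 := Derivation.map_natCast _ 2
      simp only [map_add, Derivation.map_smul, Derivation.leibniz, c, e1, e2, e3, x0, x1, two,
        map_zero, smul_zero, add_zero] at h
      simpa using h
    · exact ih m hlt
  have start : ∃ N, ∀ m, N ≤ m → pderiv m p = 0 := by
    refine ⟨p.vars.sup id + 1, fun m hm => pderiv_eq_zero_of_notMem_vars fun hmem => ?_⟩
    have := Finset.le_sup (f := id) hmem
    simp only [id] at this
    omega
  obtain ⟨N, hN⟩ := start
  have all : ∀ m, 0 ≤ m → pderiv m p = 0 := by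
    induction N with
    | zero => exact hN
    | succ k ih => exact ih (key k hN)
  have c0 : ∀ q, pderiv 0 q = 0 → pderiv 0 (D q) = 0 := by
    intro q
    have h : ⁅(pderiv 0 : Derivation ℚ (MvPolynomial ℕ ℚ) (MvPolynomial ℕ ℚ)), D⁆ = 0 := by
      apply MvPolynomial.derivation_ext
      intro i
      rw [Derivation.commutator_apply, hD]
      simp only [pderiv_X, Pi.single_apply]
      by_cases h1 : i = 0
      · subst h1; simp
      · simp [h1]
    have h' := congrArg (fun d => d q) h
    simp only [Derivation.commutator_apply, Derivation.zero_apply] at h'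
    intro h0
    rwa [h0, map_zero, sub_zero] at h'
  have a0 := all 0 le_rfl
  have a1 := all 1 (by omega)
  have b0 := c0 _ a0
  have b00 := c0 _ b0
  have b1 : pderiv 1 (D p) = 0 := by rw [c 0, a0, a1]; simp
  have b2 : pderiv 1 (D (D p)) = 0 := by rw [c 0, b0, b1]; simp
  have b3 : pderiv 1 (D (D (D p))) = 0 := by rw [c 0, b00, b2]; simp
  have h := congrArg (pderiv 1) hp
  have x0 : pderiv 1 (X 0 : MvPolynomial ℕ ℚ) = 0 := pderiv_X_of_ne (by omega)
  have two : pderiv 1 (2 : MvPolynomial ℕ ℚ) = 0 := Derivation.map_natCast _ 2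
  simp only [map_add, Derivation.map_smul, Derivation.leibniz, b1, b3, a1, x0, two,
    pderiv_X_self, map_zero, smul_zero, add_zero, zero_add] at h
  simpa using h
end

section
/- The operator A₂ is nondegenerate in the sense that A₂ ∘ ∇ = 0 implies ∇ = 0 for total differential operators ∇: if (c_k)_{k∈ℕ} is a finitely supported family of elements of R such that A₂(Σ_k c_k·D^k(p)) = 0 for every p ∈ R, then c_k = 0 for every k. -/
open MvPolynomial

theorem aux_comm (D : Derivation ℚ (MvPolynomial ℕ ℚ) (MvPolynomial ℕ ℚ))
    (hD : ∀ n : ℕ, D (X n) = X (n + 1)) (m : ℕ) (q : MvPolynomial ℕ ℚ) :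
    pderiv (m + 1) (D q) = D (pderiv (m + 1) q) + pderiv m q := by
  have key : ⁅(pderiv (m + 1) : Derivation ℚ (MvPolynomial ℕ ℚ) (MvPolynomial ℕ ℚ)), D⁆
      = pderiv m := by
    apply derivation_ext
    intro i
    rw [Derivation.commutator_apply, hD]
    by_cases h1 : i = m + 1
    · subst h1
      simp [pderiv_X_of_ne]
    · rw [pderiv_X_of_ne h1]
      by_cases h2 : i = m
      · subst h2; simp
      · rw [pderiv_X_of_ne h2, pderiv_X_of_ne (by omega)]; simp
  have := congrArg (fun E => E q) key
  simp only [Derivation.commutator_apply] at this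
  rw [← this]; ring

theorem aux_const (D : Derivation ℚ (MvPolynomial ℕ ℚ) (MvPolynomial ℕ ℚ))
    (q : MvPolynomial ℕ ℚ) (h : ∀ j, pderiv j q = 0) : D q = 0 := by
  have h0 : KaehlerDifferential.D ℚ (MvPolynomial ℕ ℚ) q = 0 := by
    apply (KaehlerDifferential.mvPolynomialBasis ℚ ℕ).repr.injective
    ext1 i
    rw [KaehlerDifferential.mvPolynomialBasis_repr_apply, h]
    simp
  rw [← Derivation.liftKaehlerDifferential_comp_D D q, h0, map_zero]

theorem aux_ker (D : Derivation ℚ (MvPolynomial ℕ ℚ) (MvPolynomial ℕ ℚ))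
    (hD : ∀ n : ℕ, D (X n) = X (n + 1)) (q : MvPolynomial ℕ ℚ)
    (h : -((1 : ℚ)/2) • D (D (D q)) + 2 * X 0 * D q + X 1 * q = 0) : q = 0 := by
  have step : ∀ (N : ℕ) (r : MvPolynomial ℕ ℚ), (∀ j, N ≤ j → pderiv j r = 0) →
      ∀ j, N + 1 ≤ j → pderiv j (D r) = 0 := by
    intro N r hr j hj
    obtain ⟨i, rfl⟩ : ∃ i, j = i + 1 := ⟨j - 1, by omega⟩
    rw [aux_comm D hD, hr _ (by omega), hr _ (by omega)]; simp
  have down : ∀ N : ℕ, (∀ j, N ≤ j → pderiv j q = 0) → ∀ j, pderiv j q = 0 := by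
    intro N
    induction N with
    | zero => intro h j; exact h j (Nat.zero_le j)
    | succ N ih =>
      intro hN
      apply ih
      intro j hj
      rcases Nat.lt_or_ge N j with h1 | h1
      · exact hN j h1
      obtain rfl : j = N := by omega
      have s1 := step _ _ hN
      have s2 := step _ _ s1
      have h2 := congrArg (pderiv (j + 3)) h
      have e : pderiv (j + 3) (D (D (D q))) = pderiv j q := by
        rw [aux_comm D hD, s2 _ (by omega), aux_comm D hD, s1 _ (by omega), aux_comm D hD,
          hN _ (by omega)]
        simp
      have x0 : pderiv (j + 3) (2 * X 0 * D q) = 0 := by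
        rw [mul_assoc, show (2 : MvPolynomial ℕ ℚ) = C 2 from rfl, pderiv_C_mul, pderiv_mul,
          s1 _ (by omega), pderiv_X_of_ne (by omega)]
        simp
      have x1 : pderiv (j + 3) (X 1 * q) = 0 := by
        rw [pderiv_mul, hN _ (by omega), pderiv_X_of_ne (by omega)]
        simp
      rw [map_add, map_add, x0, x1, Derivation.map_smul, e, map_zero, add_zero, add_zero] at h2
      exact (smul_eq_zero.mp h2).resolve_left (by norm_num)
  have all := down (q.vars.sup id + 1) (by
    intro j hj
    apply pderiv_eq_zero_of_notMem_vars
    intro hm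
    have := Finset.le_sup (f := id) hm
    simp only [id] at this
    omega)
  rw [aux_const D q all] at h
  simpa using h

/-- The operator `A₂` is nondegenerate: `A₂ ∘ ∇ = 0` implies `∇ = 0` for every
total differential operator `∇(p) = ∑ₖ cₖ·Dᵏ(p)`. -/
theorem kdv_A2_nondegenerate
    (D : Derivation ℚ (MvPolynomial ℕ ℚ) (MvPolynomial ℕ ℚ))
    (hD : ∀ n : ℕ, D (X n) = X (n + 1))
    (A₂ : MvPolynomial ℕ ℚ → MvPolynomial ℕ ℚ)
    (hA₂ : ∀ p, A₂ p = -((1 : ℚ)/2) • (D.toLinearMap ^ 3) p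
        + 2 * X 0 * D p + X 1 * p)
    (c : ℕ →₀ MvPolynomial ℕ ℚ)
    (h : ∀ p : MvPolynomial ℕ ℚ,
      A₂ (c.sum fun k ck => ck * (D.toLinearMap ^ k) p) = 0) :
    ∀ k : ℕ, c k = 0 := by
  intro k
  have pw : ∀ k n : ℕ, (D.toLinearMap ^ k) (X n) = X (n + k) := by
    intro k
    induction k with
    | zero => intro n; simp
    | succ k ih =>
      intro n
      rw [pow_succ, Module.End.mul_apply]
      have : D.toLinearMap (X n) = X (n + 1) := hD n
      rw [this, ih]
      congr 1; omega
  let n : ℕ := (c.support.biUnion fun k => (c k).vars).sup id + 1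
  have hn : ∀ i j, pderiv (n + j) (c i) = 0 := by
    intro i j
    by_cases hi : c i = 0
    · simp [hi]
    apply pderiv_eq_zero_of_notMem_vars
    intro hm
    have hm' : n + j ∈ c.support.biUnion fun k => (c k).vars :=
      Finset.mem_biUnion.mpr ⟨i, by simpa using hi, hm⟩
    have := Finset.le_sup (f := id) hm'
    simp only [id] at this
    omega
  have h1 := h (X n)
  rw [hA₂] at h1
  have h2 := aux_ker D hD _ h1
  have h3 := congrArg (pderiv (n + k)) h2
  simp only [pw] at h3
  rw [Finsupp.sum, map_sum, map_zero, Finset.sum_eq_single k] at h3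
  · rw [pderiv_mul, hn] at h3
    simpa using h3
  · intro b _ hb
    rw [pderiv_mul, hn, pderiv_X_of_ne (by omega)]
    simp
  · intro hk
    simp [Finsupp.notMem_support_iff.mp hk]
end

section
/- For all p, q ∈ R' that are polynomials in the base variable x alone (i.e. p, q lie in the image of Polynomial ℚ under the embedding sending the indeterminate to x), one has E_{□(p)}(□(q)) − E_{□(q)}(□(p)) = □(D(p)·q − p·D(q)). Equivalently, the image of the operator □ = u_x + (1/2)z²·d/dx, which generates the x-family of point symmetries of the heavenly Toda equation u_{xy} = exp(−u_{zz}), is closed under commutation of evolutionary vector fields, with induced bracket [p,q]_□ = D(p)·q − p·D(q). -/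
open MvPolynomial

/-- The image of the operator `□ = u_x + (1/2)z²·d/dx`, generating the
`x`-family of point symmetries of the heavenly Toda equation
`u_{xy} = exp(−u_{zz})`, is closed under commutation of evolutionary vector
fields on functions of `x` alone, with induced bracket
`[p,q]_□ = D(p)·q − p·D(q)`.  Here `u_n = X (Sum.inl n)`, `x = X (Sum.inr 0)`,
`z = X (Sum.inr 1)`. -/
theorem heavenly_toda_box_image_closed
    (D : Derivation ℚ (MvPolynomial (ℕ ⊕ Fin 2) ℚ) (MvPolynomial (ℕ ⊕ Fin 2) ℚ))
    (hDu : ∀ n : ℕ, D (X (Sum.inl n)) = X (Sum.inl (n + 1)))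
    (hDx : D (X (Sum.inr 0)) = 1)
    (hDz : D (X (Sum.inr 1)) = 0)
    (E : MvPolynomial (ℕ ⊕ Fin 2) ℚ →
      Derivation ℚ (MvPolynomial (ℕ ⊕ Fin 2) ℚ) (MvPolynomial (ℕ ⊕ Fin 2) ℚ))
    (hEu : ∀ φ (n : ℕ), E φ (X (Sum.inl n)) = (D.toLinearMap ^ n) φ)
    (hEbase : ∀ φ (i : Fin 2), E φ (X (Sum.inr i)) = 0)
    (Box : MvPolynomial (ℕ ⊕ Fin 2) ℚ → MvPolynomial (ℕ ⊕ Fin 2) ℚ)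
    (hBox : ∀ p, Box p = X (Sum.inl 1) * p
        + ((1 : ℚ)/2) • (X (Sum.inr 1) ^ 2 * D p)) :
    ∀ p q : MvPolynomial (ℕ ⊕ Fin 2) ℚ,
      p ∈ Set.range (Polynomial.aeval (X (Sum.inr 0) : MvPolynomial (ℕ ⊕ Fin 2) ℚ) :
          Polynomial ℚ → MvPolynomial (ℕ ⊕ Fin 2) ℚ) →
      q ∈ Set.range (Polynomial.aeval (X (Sum.inr 0) : MvPolynomial (ℕ ⊕ Fin 2) ℚ) :
          Polynomial ℚ → MvPolynomial (ℕ ⊕ Fin 2) ℚ) →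
      E (Box p) (Box q) - E (Box q) (Box p) = Box (D p * q - p * D q) := by
  rintro _ _ ⟨P, rfl⟩ ⟨Q, rfl⟩
  have hE : ∀ φ (S : Polynomial ℚ), E φ (Polynomial.aeval (X (Sum.inr 0)) S) = 0 := by
    intro φ S
    rw [Derivation.map_aeval, hEbase, smul_zero]
  have hD : ∀ S : Polynomial ℚ, D (Polynomial.aeval (X (Sum.inr 0)) S)
      = Polynomial.aeval (X (Sum.inr 0)) (Polynomial.derivative S) := by
    intro S
    rw [Derivation.map_aeval, hDx, smul_eq_mul, mul_one]
  have key : ∀ φ (S : Polynomial ℚ), E φ (Box (Polynomial.aeval (X (Sum.inr 0)) S))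
      = Polynomial.aeval (X (Sum.inr 0)) S * D φ := by
    intro φ S
    have h1 : E φ (X (Sum.inl 1)) = D φ := by rw [hEu, pow_one]; rfl
    rw [hBox, hD]
    simp [Derivation.leibniz, Derivation.leibniz_pow, hE, hEbase, h1]
  have hz : D (X (Sum.inr 1) ^ 2) = 0 := by simp [Derivation.leibniz_pow, hDz]
  have hu := hDu 1
  have hC : D (C ((1 : ℚ) / 2)) = 0 := D.map_algebraMap _
  rw [key, key, hBox, hBox, hBox]
  simp only [map_add, map_sub, Derivation.leibniz, hC, hz, hu, hD, smul_eq_mul,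
    MvPolynomial.smul_eq_C_mul]
  ring
end

section
/- The commutator of two evolutionary derivations is the evolutionary derivation whose generating section is given by the standard bracket of generating sections: for all φ, ψ ∈ R and all f ∈ R, E_φ(E_ψ(f)) − E_ψ(E_φ(f)) = E_{E_φ(ψ) − E_ψ(φ)}(f). -/
open MvPolynomial

/-- The commutator of two evolutionary derivations is the evolutionary
derivation with generating section `E_φ(ψ) − E_ψ(φ)`. -/
theorem evolutionary_commutator
    (D : Derivation ℚ (MvPolynomial ℕ ℚ) (MvPolynomial ℕ ℚ))
    (hD : ∀ n : ℕ, D (X n) = X (n + 1))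
    (E : MvPolynomial ℕ ℚ → Derivation ℚ (MvPolynomial ℕ ℚ) (MvPolynomial ℕ ℚ))
    (hE : ∀ (φ : MvPolynomial ℕ ℚ) (n : ℕ), E φ (X n) = (D.toLinearMap ^ n) φ) :
    ∀ φ ψ f : MvPolynomial ℕ ℚ,
      E φ (E ψ f) - E ψ (E φ f) = E (E φ ψ - E ψ φ) f := by
  have hcomm : ∀ φ g : MvPolynomial ℕ ℚ, E φ (D g) = D (E φ g) := by
    intro φ g
    have h : ⁅E φ, D⁆ = 0 := by
      apply MvPolynomial.derivation_ext
      intro n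
      have h1 : E φ (X (n + 1)) = D (E φ (X n)) := by
        rw [hE, hE, pow_succ']
        rfl
      rw [Derivation.commutator_apply, hD, h1, sub_self]
      rfl
    have h2 := congrArg (fun d => d g) h
    simp only [Derivation.commutator_apply, Derivation.coe_zero, Pi.zero_apply] at h2
    exact sub_eq_zero.mp h2
  have hpow : ∀ (φ g : MvPolynomial ℕ ℚ) (n : ℕ),
      E φ ((D.toLinearMap ^ n) g) = (D.toLinearMap ^ n) (E φ g) := by
    intro φ g n
    induction n with
    | zero => rfl
    | succ k ih =>
      rw [pow_succ', Module.End.mul_apply, Module.End.mul_apply, ← ih]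
      exact hcomm φ _
  intro φ ψ f
  have h : ⁅E φ, E ψ⁆ = E (E φ ψ - E ψ φ) := by
    apply MvPolynomial.derivation_ext
    intro n
    rw [Derivation.commutator_apply, hE, hE, hE, hpow, hpow, map_sub]
  rw [← h, Derivation.commutator_apply]
end

section
/- The bracket φ ∗ ψ := E_φ(ψ) − E_ψ(φ) on R satisfies the Jacobi identity: for all φ, ψ, χ ∈ R, (φ ∗ ψ) ∗ χ + (ψ ∗ χ) ∗ φ + (χ ∗ φ) ∗ ψ = 0. Together with its antisymmetry this makes (R, ∗) a Lie algebra over ℚ (the Lie algebra g(π) of generating sections of evolutionary vector fields). -/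
open MvPolynomial

/-- The standard bracket `φ ∗ ψ = E_φ(ψ) − E_ψ(φ)` of generating sections is
antisymmetric and satisfies the Jacobi identity, making `R` the Lie algebra of
generating sections of evolutionary vector fields. -/
theorem generating_sections_jacobi
    (D : Derivation ℚ (MvPolynomial ℕ ℚ) (MvPolynomial ℕ ℚ))
    (hD : ∀ n : ℕ, D (X n) = X (n + 1))
    (E : MvPolynomial ℕ ℚ → Derivation ℚ (MvPolynomial ℕ ℚ) (MvPolynomial ℕ ℚ))
    (hE : ∀ (φ : MvPolynomial ℕ ℚ) (n : ℕ), E φ (X n) = (D.toLinearMap ^ n) φ)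
    (s : MvPolynomial ℕ ℚ → MvPolynomial ℕ ℚ → MvPolynomial ℕ ℚ)
    (hs : ∀ φ ψ, s φ ψ = E φ ψ - E ψ φ) :
    (∀ φ ψ : MvPolynomial ℕ ℚ, s φ ψ = - s ψ φ) ∧
    (∀ φ ψ χ : MvPolynomial ℕ ℚ,
      s (s φ ψ) χ + s (s ψ χ) φ + s (s χ φ) ψ = 0) := by
  have hcomm : ∀ φ : MvPolynomial ℕ ℚ, ⁅E φ, D⁆ = 0 := by
    intro φ
    apply MvPolynomial.derivation_ext
    intro n
    rw [Derivation.commutator_apply, hD, hE, hE, pow_succ', Module.End.mul_apply]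
    simp
  have hc : ∀ φ p : MvPolynomial ℕ ℚ, E φ (D p) = D (E φ p) := by
    intro φ p
    have h := congrArg (fun d => d p) (hcomm φ)
    simp only [Derivation.commutator_apply, Derivation.zero_apply] at h
    exact sub_eq_zero.mp h
  have hp : ∀ (n : ℕ) (φ p : MvPolynomial ℕ ℚ),
      E φ ((D.toLinearMap ^ n) p) = (D.toLinearMap ^ n) (E φ p) := by
    intro n φ p
    induction n with
    | zero => simp
    | succ k ih =>
      rw [pow_succ', Module.End.mul_apply, Module.End.mul_apply, ← ih]
      exact hc _ _
  have hb : ∀ φ ψ : MvPolynomial ℕ ℚ, E (s φ ψ) = ⁅E φ, E ψ⁆ := by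
    intro φ ψ
    apply MvPolynomial.derivation_ext
    intro n
    rw [Derivation.commutator_apply, hE, hE, hE, hp, hp, hs, map_sub]
  refine ⟨fun φ ψ => by rw [hs, hs]; ring, fun φ ψ χ => ?_⟩
  rw [hs (s φ ψ), hs (s ψ χ), hs (s χ φ), hb, hb, hb]
  simp only [Derivation.commutator_apply, hs, map_sub]
  ring
end
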